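/- arXiv:2406.16340 — 2 statements merged into one kernel-verified Lean document; each statement's English description precedes it below -/
import Mathlib

section
/- Let H be an n×n complex Hermitian matrix and let λ ≠ μ be two distinct eigenvalues of H, of algebraic multiplicities s and p respectively. Then (D_s(λ·1 − H))ᴴ * D_p(μ·1 − H) = 0, where ᴴ denotes the conjugate transpose; that is, every column of D_s(λ·1 − H) is orthogonal, with respect to the standard Hermitian inner product on ℂ^n, to every column of D_p(μ·1 − H). -/
open scoped Matrix

/-- The reduced order-one complement of order `s` of an `n×n` matrix `A`:
the matrix whose `(i,j)` entry is the coefficient of `z^(n-s)` in the `(i,j)` entry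
of `adjugate (1 + z • A)`, computed over the polynomial ring `R[z]`. -/
noncomputable def redComp {R : Type*} [CommRing R] {n : ℕ} (s : ℕ)
    (A : Matrix (Fin n) (Fin n) R) : Matrix (Fin n) (Fin n) R :=
  Matrix.of fun i j =>
    (((1 + (Polynomial.X : Polynomial R) • A.map (fun a => Polynomial.C a) :
        Matrix (Fin n) (Fin n) (Polynomial R)).adjugate) i j).coeff (n - s)

namespace Matrix

open Polynomial

variable {R : Type*} [CommRing R] {n : ℕ}

lemma natDegree_det_one_add_X_smul_le (H : Matrix (Fin n) (Fin n) R) (a : R) :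
    (1 + (X : R[X]) • (a • (1 : Matrix (Fin n) (Fin n) R) - H).map (fun b => C b)).det.natDegree ≤
      n - H.charpoly.rootMultiplicity a := by
  nontriviality R
  have h : (1 + (X : R[X]) • (a • (1 : Matrix (Fin n) (Fin n) R) - H).map (fun b => C b)).det =
      (H - scalar (Fin n) a).charpolyRev := by
    rw [charpolyRev]
    congr 1
    ext1 i j
    simp only [add_apply, sub_apply, smul_apply, map_apply, scalar_apply, smul_eq_mul,
      map_sub, diagonal_apply, one_apply]
    split_ifs
    · simp; ring
    · simp
  rw [h, ← reverse_charpoly, reverse_natDegree, charpoly_sub_scalar,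
    ← rootMultiplicity_eq_natTrailingDegree, ← taylor_apply, natDegree_taylor,
    charpoly_natDegree_eq_dim, Fintype.card_fin]

/-- Beyond the degree of `det (1 + z • A)`, the coefficients of `adjugate (1 + z • A)` satisfy
a first-order recursion. -/
lemma coeff_adjugate_succ (A : Matrix (Fin n) (Fin n) R) {k : ℕ}
    (hk : (1 + (X : R[X]) • A.map (fun b => C b)).det.natDegree ≤ k) :
    (of fun i j => ((1 + (X : R[X]) • A.map (fun b => C b)).adjugate i j).coeff (k + 1)) =
      -(A * of fun i j => ((1 + (X : R[X]) • A.map (fun b => C b)).adjugate i j).coeff k) := by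
  ext i j
  set Q := (1 + (X : R[X]) • A.map (fun b => C b)).adjugate with hQ
  have h := mul_adjugate (1 + (X : R[X]) • A.map (fun b => C b))
  rw [← hQ, add_mul, one_mul, Matrix.smul_mul] at h
  replace h := congrArg (fun M : Matrix (Fin n) (Fin n) R[X] => (M i j).coeff (k + 1)) h
  have hdet := coeff_eq_zero_of_natDegree_lt (Nat.lt_succ_of_le hk)
  simp only [add_apply, smul_apply, smul_eq_mul, coeff_add,
    coeff_X_mul, mul_apply, finsetSum_coeff, map_apply, coeff_C_mul] at h
  have hz : (det (1 + (X : R[X]) • A.map (fun b => C b)) *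
      (1 : Matrix (Fin n) (Fin n) R[X]) i j).coeff (k + 1) = 0 := by
    rw [one_apply]
    split_ifs
    · rw [mul_one]; exact hdet
    · simp
  rw [hz] at h
  simpa [mul_apply] using eq_neg_of_add_eq_zero_left h

lemma exists_pow_mul_redComp_eq_zero (H : Matrix (Fin n) (Fin n) R) (a : R) :
    ∃ m : ℕ, (a • (1 : Matrix (Fin n) (Fin n) R) - H) ^ m *
      redComp (H.charpoly.rootMultiplicity a) (a • 1 - H) = 0 := by
  set A := a • (1 : Matrix (Fin n) (Fin n) R) - H with hA
  set s := H.charpoly.rootMultiplicity a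
  let Q : ℕ → Matrix (Fin n) (Fin n) R := fun k =>
    of fun i j => ((1 + (X : R[X]) • A.map (fun b => C b)).adjugate i j).coeff k
  have hpow (m : ℕ) : Q (n - s + m) = (-1 : R) ^ m • (A ^ m * redComp s A) := by
    induction m with
    | zero => simp [Q, redComp]
    | succ m ih =>
      have hstep : Q (n - s + m + 1) = -(A * Q (n - s + m)) :=
        coeff_adjugate_succ A
          ((natDegree_det_one_add_X_smul_le H a).trans (Nat.le_add_right _ m))
      rw [← add_assoc, hstep, ih, mul_smul_comm, ← mul_assoc, ← pow_succ', pow_succ (-1 : R)]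
      simp
  let N := Finset.univ.sup fun i => Finset.univ.sup fun j =>
    ((1 + (X : R[X]) • A.map (fun b => C b)).adjugate i j).natDegree
  have hN : Q (n - s + (N + 1)) = 0 := by
    ext i j
    refine coeff_eq_zero_of_natDegree_lt
      (p := (1 + (X : R[X]) • A.map (fun b => C b)).adjugate i j) ?_
    have h₁ : ((1 + (X : R[X]) • A.map (fun b => C b)).adjugate i j).natDegree ≤ N :=
      (Finset.le_sup (f := fun j =>
        ((1 + (X : R[X]) • A.map (fun b => C b)).adjugate i j).natDegree)
        (Finset.mem_univ j)).trans
      (Finset.le_sup (f := fun i => Finset.univ.sup fun j =>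
        ((1 + (X : R[X]) • A.map (fun b => C b)).adjugate i j).natDegree) (Finset.mem_univ i))
    omega
  refine ⟨N + 1, ?_⟩
  have h := hpow (N + 1)
  rw [hN] at h
  have hu : IsUnit ((-1 : R) ^ (N + 1)) := isUnit_one.neg.pow _
  exact hu.smul_eq_zero.mp h.symm

lemma IsHermitian.star_eq_self_of_isRoot_charpoly {𝕜 : Type*} [RCLike 𝕜]
    {H : Matrix (Fin n) (Fin n) 𝕜} (hH : H.IsHermitian) {a : 𝕜} (ha : H.charpoly.IsRoot a) :
    star a = a := by
  rw [hH.charpoly_eq, IsRoot.def, eval_prod, Finset.prod_eq_zero_iff] at ha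
  obtain ⟨i, -, hi⟩ := ha
  rw [eval_sub, eval_X, eval_C, sub_eq_zero] at hi
  simp [hi]

/-- Matrices annihilated by powers of `a - H` and `b - H` respectively, with `H` Hermitian, `a`
self-adjoint and `a - b` invertible, have mutually orthogonal columns. -/
lemma IsHermitian.conjTranspose_mul_eq_zero_of_pow_mul_eq_zero [StarRing R]
    {H : Matrix (Fin n) (Fin n) R} (hH : H.IsHermitian) {a b : R} (hab : IsUnit (a - b))
    (ha : star a = a) {D E : Matrix (Fin n) (Fin n) R} {k l : ℕ}
    (hD : (a • (1 : Matrix (Fin n) (Fin n) R) - H) ^ k * D = 0)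
    (hE : (b • (1 : Matrix (Fin n) (Fin n) R) - H) ^ l * E = 0) : Dᴴ * E = 0 := by
  have hD' : Dᴴ * (a • (1 : Matrix (Fin n) (Fin n) R) - H) ^ k = 0 := by
    simpa [conjTranspose_mul, conjTranspose_pow, ha, hH.eq] using congrArg (·ᴴ) hD
  have hcop : IsCoprime ((C a - X) ^ k) ((C b - X) ^ l) := by
    refine IsCoprime.pow ?_
    obtain ⟨u, hu⟩ := hab
    refine ⟨C (↑u⁻¹ : R), -C (↑u⁻¹ : R), ?_⟩
    calc C (↑u⁻¹ : R) * (C a - X) + -C (↑u⁻¹ : R) * (C b - X)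
        = C (↑u⁻¹ * (a - b)) := by rw [C_mul, C_sub]; ring
      _ = 1 := by rw [← hu, Units.inv_mul, C_1]
  obtain ⟨f, g, hfg⟩ := hcop
  rw [mul_comm f] at hfg
  have h := congrArg (aeval H) hfg
  simp only [map_add, map_mul, map_pow, map_sub, aeval_C, aeval_X, map_one,
    Algebra.algebraMap_eq_smul_one] at h
  rw [← mul_one Dᴴ, ← h, mul_add, add_mul, ← mul_assoc, hD', zero_mul, zero_mul, zero_add,
    mul_assoc, mul_assoc, hE, mul_zero, mul_zero]

end Matrix

/-- Let `H` be an `n×n` complex Hermitian matrix and let `λ ≠ μ` be two distinct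
eigenvalues of `H`, of algebraic multiplicities `s` and `p` respectively.  Then
`(redComp s (λ•1 - H))ᴴ * redComp p (μ•1 - H) = 0`: every column of the first
reduced complement is orthogonal to every column of the second. -/
theorem redComp_charmatrix_orthogonal {n : ℕ} (H : Matrix (Fin n) (Fin n) ℂ)
    (hH : H.IsHermitian) (lam mu : ℂ) (hne : lam ≠ mu) (s p : ℕ)
    (hs : 1 ≤ s) (hp : 1 ≤ p)
    (hmuls : Polynomial.rootMultiplicity lam (Matrix.charpoly H) = s)
    (hmulp : Polynomial.rootMultiplicity mu (Matrix.charpoly H) = p) :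
    (redComp s (lam • (1 : Matrix (Fin n) (Fin n) ℂ) - H))ᴴ *
        redComp p (mu • (1 : Matrix (Fin n) (Fin n) ℂ) - H) = 0 := by
  have hroot : (Matrix.charpoly H).IsRoot lam :=
    (Polynomial.rootMultiplicity_pos H.charpoly_monic.ne_zero).mp (by omega)
  subst hmuls hmulp
  obtain ⟨k, hk⟩ := Matrix.exists_pow_mul_redComp_eq_zero H lam
  obtain ⟨l, hl⟩ := Matrix.exists_pow_mul_redComp_eq_zero H mu
  exact hH.conjTranspose_mul_eq_zero_of_pow_mul_eq_zero (sub_ne_zero.mpr hne).isUnit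
    (hH.star_eq_self_of_isRoot_charpoly hroot) hk hl
end

section
/- Let A be an n×n complex matrix and let 0 ≤ s ≤ n. Then the diagonal sum of the minor determinants of order n−s of A satisfies ∑_{J} det(A.submatrix e_J e_J) = ∑_{(k_1,…,k_{n−s})} ∏_{l=1}^{n−s} (−1)^(k_l + 1) / (l^(k_l) · k_l!) · (Tr(A^l))^(k_l), where the left-hand sum runs over all (n−s)-element subsets J of Fin n, and the right-hand sum runs over all tuples (k_1, …, k_{n−s}) of non-negative integers satisfying ∑_{l=1}^{n−s} l·k_l = n − s. -/
open Polynomial in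
/-- **Jacobi's formula** for the determinant of a matrix of polynomials. -/
lemma Matrix.derivative_det_eq_trace_adjugate_mul {ι R : Type*} [Fintype ι] [DecidableEq ι]
    [CommRing R] (M : Matrix ι ι R[X]) :
    derivative M.det = (M.adjugate * M.map derivative).trace := by
  have hcol : ∀ i, (M.adjugate * M.map derivative) i i
      = (M.updateCol i fun j => derivative (M j i)).det := by
    intro i
    rw [← Matrix.cramer_apply, Matrix.cramer_eq_adjugate_mulVec]
    rfl
  simp only [Matrix.trace, Matrix.diag_apply, hcol]
  simp only [Matrix.det_apply', derivative_sum]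
  rw [Finset.sum_comm]
  refine Finset.sum_congr rfl fun σ _ => ?_
  rw [← Polynomial.C_eq_intCast, derivative_C_mul, derivative_prod_finset, Finset.mul_sum]
  refine Finset.sum_congr rfl fun i _ => ?_
  rw [← Finset.prod_erase_mul _ _ (Finset.mem_univ i), Matrix.updateCol_self]
  congr 2
  refine Finset.prod_congr rfl fun j hj => ?_
  rw [Matrix.updateCol_ne (Finset.ne_of_mem_erase hj)]

open Polynomial in
/-- **Newton's identities** for the sums of principal minors of a matrix, written as the
coefficients of `det (1 + X A)`, and the traces of its powers. -/
lemma Matrix.newton_identity_coeff_det_one_add_X_smul {ι R : Type*} [Fintype ι] [DecidableEq ι]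
    [CommRing R] (A : Matrix ι ι R) (m : ℕ) :
    ((m : R) + 1) * (det (1 + (X : R[X]) • A.map C)).coeff (m + 1)
      = ∑ i ∈ Finset.range (m + 1),
          (-1) ^ i * (A ^ (i + 1)).trace * (det (1 + (X : R[X]) • A.map C)).coeff (m - i) := by
  set M : Matrix ι ι R[X] := 1 + (X : R[X]) • A.map C with hM
  let T : ℕ → Matrix ι ι R := fun k => M.adjugate.map (fun p => p.coeff k)
  have hadj : M.adjugate + (X : R[X]) • (M.adjugate * A.map C) = M.det • 1 := by
    rw [← Matrix.adjugate_mul, hM, mul_add, mul_one, Matrix.mul_smul]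
  have hcoeff : ∀ k, (M.adjugate * A.map C).map (fun p => p.coeff k) = T k * A := by
    intro k
    ext i j
    simp [T, Matrix.mul_apply, finsetSum_coeff]
  have hT0 : T 0 = M.det.coeff 0 • 1 := by
    ext i j
    have h := congrArg (fun N : Matrix ι ι R[X] => (N i j).coeff 0) hadj
    simpa [T, Matrix.one_apply, apply_ite (fun p : R[X] => p.coeff 0)] using h
  have hTs : ∀ k, T (k + 1) = M.det.coeff (k + 1) • 1 - T k * A := by
    intro k
    ext i j
    have h := congrArg (fun N : Matrix ι ι R[X] => (N i j).coeff (k + 1)) hadj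
    rw [← hcoeff, Matrix.sub_apply, eq_sub_iff_add_eq]
    by_cases hij : i = j <;> simpa [T, Matrix.one_apply, hij] using h
  have hT : ∀ k, T k = ∑ i ∈ Finset.range (k + 1), ((-1) ^ i * M.det.coeff (k - i)) • A ^ i := by
    intro k
    induction k with
    | zero => simp [hT0]
    | succ k ih =>
      rw [hTs, ih, Finset.sum_range_succ' _ (k + 1), Finset.sum_mul, sub_eq_add_neg, add_comm,
        ← Finset.sum_neg_distrib]
      congr 1
      · refine Finset.sum_congr rfl fun i _ => ?_
        rw [Nat.add_sub_add_right, Matrix.smul_mul, ← pow_succ, ← neg_smul]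
        congr 1
        ring
      · simp
  have hder : M.map derivative = A.map C := by
    ext1 i j
    by_cases hij : i = j <;> simp [hM, hij]
  have hjac := congrArg (fun p : R[X] => p.coeff m) M.derivative_det_eq_trace_adjugate_mul
  have htr : ((M.adjugate * A.map C).trace).coeff m = (T m * A).trace := by
    rw [← hcoeff]
    simp [Matrix.trace, finsetSum_coeff]
  simp only [hder, htr, coeff_derivative] at hjac
  rw [mul_comm, hjac, hT, Finset.sum_mul, Matrix.trace_sum]
  refine Finset.sum_congr rfl fun i _ => ?_
  rw [Matrix.smul_mul, ← pow_succ, Matrix.trace_smul, smul_eq_mul]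
  ring

/-- The tuples `(k_0, …, k_{N-1})` of natural numbers at most `N` with `∑ (l + 1) k_l = m`. -/
def weightedTuples (N m : ℕ) : Finset (Fin N → ℕ) :=
  (Fintype.piFinset fun _ : Fin N => Finset.range (N + 1)).filter
    (fun k : Fin N → ℕ => (∑ l : Fin N, (l.1 + 1) * k l) = m)

lemma mem_weightedTuples {N m : ℕ} (hm : m ≤ N) {k : Fin N → ℕ} :
    k ∈ weightedTuples N m ↔ ∑ l : Fin N, (l.1 + 1) * k l = m := by
  simp only [weightedTuples, Finset.mem_filter, Fintype.mem_piFinset, Finset.mem_range,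
    and_iff_right_iff_imp]
  intro h l
  have h1 : (l.1 + 1) * k l ≤ ∑ l : Fin N, (l.1 + 1) * k l :=
    Finset.single_le_sum (f := fun l : Fin N => (l.1 + 1) * k l) (fun _ _ => Nat.zero_le _)
      (Finset.mem_univ l)
  nlinarith [Nat.zero_le (l.1 * k l)]

lemma sum_mul_update_add_one {N : ℕ} (k : Fin N → ℕ) (l : Fin N) :
    ∑ j : Fin N, (j.1 + 1) * Function.update k l (k l + 1) j
      = ∑ j : Fin N, (j.1 + 1) * k j + (l.1 + 1) := by
  rw [← Finset.add_sum_erase _ _ (Finset.mem_univ l),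
    ← Finset.add_sum_erase (a := l) _ (fun j : Fin N => (j.1 + 1) * k j) (Finset.mem_univ l),
    Function.update_self, Finset.sum_congr rfl fun j hj => by
      rw [Function.update_of_ne (Finset.ne_of_mem_erase hj)]]
  ring

section ExpCoeff

variable {K : Type*} [Field K] [CharZero K]

/-- The coefficient of `X ^ m` in `exp (∑ l < N, c l * X ^ (l + 1))`, for `m ≤ N`. -/
def weightedExpCoeff (c : ℕ → K) (N m : ℕ) : K :=
  ∑ k ∈ weightedTuples N m, ∏ l : Fin N, c l ^ k l / (Nat.factorial (k l) : K)

lemma prod_update_add_one_pow_div_factorial (c : ℕ → K) {N : ℕ} (k : Fin N → ℕ) (l : Fin N) :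
    ((k l + 1 : ℕ) : K) * ∏ j : Fin N, c j ^ Function.update k l (k l + 1) j
        / (Nat.factorial (Function.update k l (k l + 1) j) : K)
      = c l * ∏ j : Fin N, c j ^ k j / (Nat.factorial (k j) : K) := by
  rw [← Finset.mul_prod_erase _ _ (Finset.mem_univ l),
    ← Finset.mul_prod_erase (a := l) _ (fun j : Fin N => c j ^ k j / (Nat.factorial (k j) : K))
      (Finset.mem_univ l),
    Function.update_self, Finset.prod_congr rfl fun j hj => by
      rw [Function.update_of_ne (Finset.ne_of_mem_erase hj)]]
  have h1 : ((k l + 1 : ℕ) : K) ≠ 0 := Nat.cast_ne_zero.mpr (Nat.succ_ne_zero _)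
  have h2 : (Nat.factorial (k l) : K) ≠ 0 := Nat.cast_ne_zero.mpr (Nat.factorial_ne_zero _)
  rw [Nat.factorial_succ, Nat.cast_mul, pow_succ, ← mul_assoc, ← mul_assoc]
  congr 1
  field_simp

lemma sum_weightedTuples_apply_mul (c : ℕ → K) {N m : ℕ} (hm : m ≤ N) (l : Fin N) :
    ∑ k ∈ weightedTuples N m, (k l : K) * ∏ j : Fin N, c j ^ k j / (Nat.factorial (k j) : K)
      = if l.1 < m then c l * weightedExpCoeff c N (m - (l.1 + 1)) else 0 := by
  split_ifs with hl
  · rw [weightedExpCoeff, Finset.mul_sum]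
    symm
    refine Finset.sum_of_injOn (fun k => Function.update k l (k l + 1)) ?_ ?_ ?_ ?_
    · intro k _ k' _ h
      funext j
      have hj := congrFun h j
      by_cases hjl : j = l
      · subst hjl
        simpa using hj
      · simpa [hjl] using hj
    · intro k hk
      rw [Finset.mem_coe, mem_weightedTuples (by omega)] at hk
      rw [Finset.mem_coe, mem_weightedTuples hm, sum_mul_update_add_one, hk]
      omega
    · intro k hk hk'
      rw [mem_weightedTuples hm] at hk
      have : k l = 0 := by
        by_contra h0
        refine hk' ⟨Function.update k l (k l - 1), ?_, ?_⟩
        · have h := sum_mul_update_add_one (Function.update k l (k l - 1)) l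
          rw [Function.update_self, Function.update_idem, Nat.sub_add_cancel (by omega),
            Function.update_eq_self, hk] at h
          rw [Finset.mem_coe, mem_weightedTuples (by omega)]
          omega
        · simp [Nat.sub_add_cancel (Nat.one_le_iff_ne_zero.mpr h0)]
      simp [this]
    · intro k _
      rw [← prod_update_add_one_pow_div_factorial, Function.update_self]
  · refine Finset.sum_eq_zero fun k hk => ?_
    rw [mem_weightedTuples hm] at hk
    have h1 : (l.1 + 1) * k l ≤ ∑ j : Fin N, (j.1 + 1) * k j :=
      Finset.single_le_sum (f := fun j : Fin N => (j.1 + 1) * k j) (fun _ _ => Nat.zero_le _)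
        (Finset.mem_univ l)
    have : k l = 0 := by
      by_contra h0
      have := Nat.le_mul_of_pos_right (l.1 + 1) (Nat.pos_of_ne_zero h0)
      omega
    simp [this]

lemma mul_weightedExpCoeff (c : ℕ → K) {N m : ℕ} (hm : m ≤ N) :
    (m : K) * weightedExpCoeff c N m
      = ∑ i ∈ Finset.range m, ((i : K) + 1) * c i * weightedExpCoeff c N (m - (i + 1)) := by
  have hsub : Finset.range m ⊆ Finset.range N := Finset.range_subset_range.mpr hm
  calc (m : K) * weightedExpCoeff c N m
      = ∑ l : Fin N, ((l.1 : K) + 1) * ∑ k ∈ weightedTuples N m,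
          (k l : K) * ∏ j : Fin N, c j ^ k j / (Nat.factorial (k j) : K) := by
        simp only [weightedExpCoeff, Finset.mul_sum]
        rw [Finset.sum_comm]
        refine Finset.sum_congr rfl fun k hk => ?_
        rw [mem_weightedTuples hm] at hk
        simp only [← mul_assoc]
        rw [← Finset.sum_mul, ← hk]
        push_cast
        rfl
    _ = ∑ l : Fin N, if l.1 < m then
          ((l.1 : K) + 1) * c l * weightedExpCoeff c N (m - (l.1 + 1)) else 0 := by
        refine Finset.sum_congr rfl fun l _ => ?_
        rw [sum_weightedTuples_apply_mul c hm, mul_ite, mul_zero, mul_assoc]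
    _ = ∑ i ∈ Finset.range m, ((i : K) + 1) * c i * weightedExpCoeff c N (m - (i + 1)) := by
        rw [Fin.sum_univ_eq_sum_range (fun i => if i < m then
          ((i : K) + 1) * c i * weightedExpCoeff c N (m - (i + 1)) else 0),
          ← Finset.sum_subset hsub fun i _ hi => if_neg (by simpa using hi)]
        exact Finset.sum_congr rfl fun i hi => if_pos (Finset.mem_range.mp hi)

lemma weightedExpCoeff_zero (c : ℕ → K) (N : ℕ) : weightedExpCoeff c N 0 = 1 := by
  have h : weightedTuples N 0 = {0} := by
    ext k
    rw [mem_weightedTuples (Nat.zero_le _)]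
    simp [funext_iff]
  simp [weightedExpCoeff, h]

lemma eq_weightedExpCoeff_of_recurrence (c E : ℕ → K) (h0 : E 0 = 1)
    (hE : ∀ m : ℕ, ((m : K) + 1) * E (m + 1)
      = ∑ i ∈ Finset.range (m + 1), ((i : K) + 1) * c i * E (m - i))
    {N m : ℕ} (hm : m ≤ N) : E m = weightedExpCoeff c N m := by
  induction m using Nat.strong_induction_on with
  | _ m ih =>
    cases m with
    | zero => rw [h0, weightedExpCoeff_zero]
    | succ m =>
      have hne : (m : K) + 1 ≠ 0 := Nat.cast_add_one_ne_zero m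
      refine mul_left_cancel₀ hne ?_
      have h := mul_weightedExpCoeff c hm
      rw [Nat.cast_succ] at h
      rw [hE, h]
      refine Finset.sum_congr rfl fun i _ => ?_
      rw [Nat.add_sub_add_right, ih (m - i) (by omega) (by omega)]

end ExpCoeff

lemma prod_neg_one_pow_add_one_of_mem_weightedTuples {N : ℕ} {k : Fin N → ℕ}
    (hk : k ∈ weightedTuples N N) :
    ∏ l : Fin N, (-1 : ℂ) ^ (k l + 1) = ∏ l : Fin N, ((-1 : ℂ) ^ l.1) ^ k l := by
  rw [mem_weightedTuples le_rfl] at hk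
  have h : ∏ l : Fin N, (-1 : ℂ) ^ ((l.1 + 1) * k l) = ∏ _l : Fin N, (-1 : ℂ) := by
    rw [Finset.prod_pow_eq_pow_sum, hk]
    simp
  simp only [pow_succ _ (k _)]
  rw [Finset.prod_mul_distrib, ← h, ← Finset.prod_mul_distrib]
  refine Finset.prod_congr rfl fun l _ => ?_
  rw [add_mul, one_mul, pow_add, mul_comm, mul_assoc, ← mul_pow, pow_mul]
  simp

open Polynomial in
lemma sum_det_submatrix_orderEmbOfFin {R : Type*} [CommRing R] {n : ℕ}
    (A : Matrix (Fin n) (Fin n) R) (m : ℕ) :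
    (∑ J : {J : Finset (Fin n) // J.card = m},
        (A.submatrix (⇑(J.1.orderEmbOfFin J.2)) (⇑(J.1.orderEmbOfFin J.2))).det)
      = (Matrix.det (1 + (X : R[X]) • A.map C)).coeff m := by
  rw [Matrix.coeff_det_one_add_X_smul_eq_sum_minors,
    Finset.sum_subtype (p := fun J : Finset (Fin n) => J.card = m) _ (by simp)]
  refine Finset.sum_congr rfl fun J _ => ?_
  rw [← Matrix.det_submatrix_equiv_self (J.1.orderIsoOfFin J.2).toEquiv]
  rfl

/-- Trace identity for the diagonal sum of minor determinants: for an `n×n`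
complex matrix `A` and `0 ≤ s ≤ n`, the sum of the principal minors of order
`n−s` of `A` equals the sum, over all tuples `(k_1, …, k_{n−s})` of non-negative
integers with `∑ l·k_l = n−s` (each `k_l ≤ n−s` is then automatic), of
`∏_{l=1}^{n−s} (−1)^(k_l+1) / (l^(k_l) · k_l!) · (Tr(A^l))^(k_l)`. -/
theorem sum_principal_minors_trace_identity {n : ℕ} (A : Matrix (Fin n) (Fin n) ℂ)
    (s : ℕ) (hs : s ≤ n) :
    (∑ J : {J : Finset (Fin n) // J.card = n - s},
        (A.submatrix (⇑(J.1.orderEmbOfFin J.2)) (⇑(J.1.orderEmbOfFin J.2))).det)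
      = ∑ k ∈ (Fintype.piFinset fun _ : Fin (n - s) => Finset.range (n - s + 1)).filter
            (fun k : Fin (n - s) → ℕ => (∑ l : Fin (n - s), (l.1 + 1) * k l) = n - s),
          ∏ l : Fin (n - s),
            (-1 : ℂ) ^ (k l + 1) / (((l.1 + 1 : ℕ) : ℂ) ^ (k l) * (Nat.factorial (k l) : ℂ))
              * (Matrix.trace (A ^ (l.1 + 1))) ^ (k l) := by
  rw [sum_det_submatrix_orderEmbOfFin]
  have key := eq_weightedExpCoeff_of_recurrence
    (fun i => (-1) ^ i * (A ^ (i + 1)).trace / ((i : ℂ) + 1))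
    (fun m => (Matrix.det (1 + (Polynomial.X : Polynomial ℂ) • A.map Polynomial.C)).coeff m)
    (by rw [Matrix.coeff_det_one_add_X_smul_eq_sum_minors]; simp)
    (fun m => by
      rw [Matrix.newton_identity_coeff_det_one_add_X_smul]
      refine Finset.sum_congr rfl fun i _ => ?_
      rw [mul_div_cancel₀ _ (Nat.cast_add_one_ne_zero i)])
    (le_refl (n - s))
  refine key.trans (Finset.sum_congr rfl fun k hk => ?_)
  simp only [div_mul_eq_mul_div, mul_div_assoc, mul_pow]
  rw [Finset.prod_mul_distrib, Finset.prod_mul_distrib,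
    prod_neg_one_pow_add_one_of_mem_weightedTuples hk]
  congr 1
  refine Finset.prod_congr rfl fun l _ => ?_
  rw [div_pow, div_div]
  push_cast
  rfl
end
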